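/- Let Ω be a finite set, F₁, F₂ ∈ D(Ω), and let G₀ = F₁ ⊎ F₂, G₁, …, G_n be a sequence of multisets of subsets of Ω obtained by successively applying properly intersecting elimination operations until G_n is laminar. Let F₃ = G_n' be the family of maximal members of G_n and F₄ = G_n ∖ F₃ (multiset difference). Then: (i) F₃, F₄ ∈ D(Ω) and ∪F₄ ⊆ (∪F₁) ∩ (∪F₂); and (ii) ∪F₄ = (∪F₁) ∩ (∪F₂) if and only if every operation in the sequence is of Type 1. -/

import Mathlib

section Pieo

variable {Ω : Type} [DecidableEq Ω]

/-- Two finite sets `X, Y` are properly intersecting if `X ∩ Y`, `X \ Y`,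
`Y \ X` are all nonempty. -/
def ProperlyIntersecting (X Y : Finset Ω) : Prop :=
  (X ∩ Y).Nonempty ∧ (X \ Y).Nonempty ∧ (Y \ X).Nonempty

/-- The three types of properly intersecting elimination operations. -/
inductive PieoType : Type
  | one : PieoType
  | two : PieoType
  | three : PieoType
deriving DecidableEq

/-- `pieoStep τ G G'` : `G'` is obtained from the multiset `G` by a properly
intersecting elimination operation (PIEO) of type `τ` on some properly
intersecting pair `X, Y` of members of `G`:  Type 1 replaces `X, Y` by `X ∪ Y`
and `X ∩ Y`, Type 2 replaces them by `X ∪ Y` only, Type 3 by `X ∩ Y` only. -/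
def pieoStep (τ : PieoType) (G G' : Multiset (Finset Ω)) : Prop :=
  ∃ X Y H, ProperlyIntersecting X Y ∧ G = X ::ₘ Y ::ₘ H ∧
    G' = (match τ with
      | PieoType.one => (X ∪ Y) ::ₘ (X ∩ Y) ::ₘ H
      | PieoType.two => (X ∪ Y) ::ₘ H
      | PieoType.three => (X ∩ Y) ::ₘ H)

/-- `G(v)`: the number of members of the multiset `G` (with multiplicity)
containing `v`. -/
def countMem (G : Multiset (Finset Ω)) (v : Ω) : ℕ :=
  Multiset.countP (fun X => v ∈ X) G

/-- A member `Z` of the multiset `G` is maximal if no member of `G` properly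
contains it. -/
def IsMaxMember (G : Multiset (Finset Ω)) (Z : Finset Ω) : Prop :=
  ∀ W ∈ G, ¬ Z ⊂ W

/-- A multiset of sets is laminar if it contains no properly intersecting pair. -/
def LaminarM (G : Multiset (Finset Ω)) : Prop :=
  ∀ X ∈ G, ∀ Y ∈ G, ¬ ProperlyIntersecting X Y

/-- The family of maximal members of `G` (each listed once). -/
def maxMembers (G : Multiset (Finset Ω)) : Multiset (Finset Ω) :=
  (G.filter fun Z => ∀ W ∈ G, ¬ Z ⊂ W).dedup

/-- The union `∪F` of all members of the multiset `F`. -/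
def msUnion (G : Multiset (Finset Ω)) : Finset Ω :=
  G.sup

/-- The partial order on families of disjoint subsets: `F ≤ G` iff every member
of `F` is contained in some member of `G`. -/
def famLE (F G : Multiset (Finset Ω)) : Prop :=
  ∀ X ∈ F, ∃ Y ∈ G, X ⊆ Y

end Pieo

section PieoLemmas

variable {Ω : Type} [DecidableEq Ω]

theorem mem_msUnion_iff_exists {F : Multiset (Finset Ω)} {v : Ω} :
    v ∈ msUnion F ↔ ∃ X ∈ F, v ∈ X := by
  induction F using Multiset.induction_on with
  | empty => simp [msUnion]
  | cons X F ih =>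
    have h : msUnion (X ::ₘ F) = X ∪ msUnion F := by simp [msUnion]
    simp [h, ih]

theorem mem_msUnion_iff_countMem_pos {F : Multiset (Finset Ω)} {v : Ω} :
    v ∈ msUnion F ↔ 0 < countMem F v := by
  rw [mem_msUnion_iff_exists, countMem, Multiset.countP_pos]

theorem countMem_cons (X : Finset Ω) (F : Multiset (Finset Ω)) (v : Ω) :
    countMem (X ::ₘ F) v = countMem F v + if v ∈ X then 1 else 0 := by
  simp [countMem, Multiset.countP_cons]

theorem pairwise_disjoint_iff_countMem_le_one {F : Multiset (Finset Ω)} :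
    (F.Pairwise fun X Y => Disjoint X Y) ↔ ∀ v, countMem F v ≤ 1 := by
  obtain ⟨l, rfl⟩ := F.exists_rep
  rw [Multiset.quot_mk_to_coe]
  have : Std.Symm fun X Y : Finset Ω => Disjoint X Y := ⟨fun _ _ h => h.symm⟩
  rw [Multiset.pairwise_coe_iff_pairwise]
  induction l with
  | nil => simp [countMem]
  | cons X l ih =>
    simp only [List.pairwise_cons, ih, ← Multiset.cons_coe, countMem_cons]
    have hzero (v : Ω) : countMem (l : Multiset (Finset Ω)) v = 0 ↔ ∀ Y ∈ l, v ∉ Y := by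
      simp [countMem]
    constructor
    · rintro ⟨hX, hl⟩ v
      split_ifs with hv
      · have := (hzero v).2 fun Y hY => Finset.disjoint_left.1 (hX Y hY) hv
        omega
      · exact hl v
    · refine fun h => ⟨fun Y hY => Finset.disjoint_left.2 fun v hv => ?_,
        fun v => (Nat.le_add_right _ _).trans (h v)⟩
      have hv' := h v
      rw [if_pos hv] at hv'
      exact (hzero v).1 (by omega) Y hY

theorem pieoStep.countMem_le {τ : PieoType} {G G' : Multiset (Finset Ω)}
    (h : pieoStep τ G G') (v : Ω) : countMem G' v ≤ countMem G v := by
  obtain ⟨X, Y, H, -, rfl, rfl⟩ := h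
  by_cases hX : v ∈ X <;> by_cases hY : v ∈ Y <;> cases τ <;> simp [countMem_cons, hX, hY]

theorem pieoStep.countMem_eq {G G' : Multiset (Finset Ω)}
    (h : pieoStep PieoType.one G G') (v : Ω) : countMem G' v = countMem G v := by
  obtain ⟨X, Y, H, -, rfl, rfl⟩ := h
  by_cases hX : v ∈ X <;> by_cases hY : v ∈ Y <;> simp [countMem_cons, hX, hY]

theorem pieoStep.exists_countMem_lt {τ : PieoType} {G G' : Multiset (Finset Ω)}
    (h : pieoStep τ G G') (hτ : τ ≠ PieoType.one) :
    ∃ v, 2 ≤ countMem G v ∧ countMem G' v < countMem G v := by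
  obtain ⟨X, Y, H, ⟨⟨v, hv⟩, -⟩, rfl, rfl⟩ := h
  obtain ⟨hX, hY⟩ := Finset.mem_inter.1 hv
  refine ⟨v, by simp [countMem_cons, hX, hY], ?_⟩
  cases τ <;> simp_all [countMem_cons]

theorem maxMembers_le (G : Multiset (Finset Ω)) : maxMembers G ≤ G :=
  (Multiset.dedup_le _).trans (Multiset.filter_le _ _)

theorem mem_maxMembers {G : Multiset (Finset Ω)} {Z : Finset Ω} :
    Z ∈ maxMembers G ↔ Z ∈ G ∧ ∀ W ∈ G, ¬ Z ⊂ W := by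
  simp [maxMembers]

theorem exists_mem_maxMembers_superset {G : Multiset (Finset Ω)} {X : Finset Ω} (hX : X ∈ G) :
    ∃ Z ∈ maxMembers G, X ⊆ Z := by
  obtain ⟨Z, hXZ, hZ⟩ := G.toFinset.exists_le_maximal (Multiset.mem_toFinset.2 hX)
  exact ⟨Z, mem_maxMembers.2 ⟨Multiset.mem_toFinset.1 hZ.prop,
    fun W hW => hZ.not_gt (Multiset.mem_toFinset.2 hW)⟩, hXZ⟩

theorem LaminarM.pairwise_disjoint_maxMembers {G : Multiset (Finset Ω)} (hG : LaminarM G) :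
    (maxMembers G).Pairwise fun X Y => Disjoint X Y := by
  refine (Multiset.nodup_dedup _).pairwise fun X hX Y hY hne => ?_
  obtain ⟨hXG, hXmax⟩ := mem_maxMembers.1 hX
  obtain ⟨hYG, hYmax⟩ := mem_maxMembers.1 hY
  by_contra hdisj
  refine hG X hXG Y hYG ⟨Finset.not_disjoint_iff_nonempty_inter.1 hdisj, ?_, ?_⟩
  · exact Finset.sdiff_nonempty.2 fun h => hXmax Y hYG (h.ssubset_of_ne hne)
  · exact Finset.sdiff_nonempty.2 fun h => hYmax X hXG (h.ssubset_of_ne hne.symm)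

theorem LaminarM.countMem_sub_maxMembers {G : Multiset (Finset Ω)} (hG : LaminarM G) (v : Ω) :
    countMem (G - maxMembers G) v = countMem G v - 1 := by
  have hle := pairwise_disjoint_iff_countMem_le_one.1 hG.pairwise_disjoint_maxMembers v
  have hpos : 0 < countMem G v → 0 < countMem (maxMembers G) v := by
    simp only [← mem_msUnion_iff_countMem_pos, mem_msUnion_iff_exists]
    rintro ⟨X, hX, hv⟩
    obtain ⟨Z, hZ, hXZ⟩ := exists_mem_maxMembers_superset hX
    exact ⟨Z, hZ, hXZ hv⟩
  have hsub : countMem (G - maxMembers G) v = countMem G v - countMem (maxMembers G) v :=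
    Multiset.countP_sub (maxMembers_le G) _
  omega

end PieoLemmas

/-- **Proposition.**  Run PIEOs on `G₀ = F₁ ⊎ F₂` (with `F₁, F₂ ∈ D(Ω)`) until
the resulting `G_n` is laminar; let `F₃` be the family of maximal members of
`G_n` and `F₄ = G_n ∖ F₃`.  Then (i) `F₃, F₄ ∈ D(Ω)` and
`∪F₄ ⊆ (∪F₁) ∩ (∪F₂)`; and (ii) `∪F₄ = (∪F₁) ∩ (∪F₂)` iff every operation in
the sequence is of Type 1. -/
theorem pieo_terminal_families
    {Ω : Type} [Fintype Ω] [DecidableEq Ω]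
    (F₁ F₂ : Multiset (Finset Ω))
    (hF₁ : F₁.Pairwise fun X Y => Disjoint X Y)
    (hF₂ : F₂.Pairwise fun X Y => Disjoint X Y)
    (n : ℕ) (G : Fin (n + 1) → Multiset (Finset Ω))
    (τ : Fin n → PieoType)
    (hG0 : G 0 = F₁ + F₂)
    (hstep : ∀ i : Fin n, pieoStep (τ i) (G i.castSucc) (G i.succ))
    (hlam : LaminarM (G (Fin.last n))) :
    ((maxMembers (G (Fin.last n))).Pairwise (fun X Y => Disjoint X Y) ∧
      (G (Fin.last n) - maxMembers (G (Fin.last n))).Pairwise (fun X Y => Disjoint X Y) ∧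
      msUnion (G (Fin.last n) - maxMembers (G (Fin.last n)))
        ⊆ msUnion F₁ ∩ msUnion F₂) ∧
    (msUnion (G (Fin.last n) - maxMembers (G (Fin.last n)))
        = msUnion F₁ ∩ msUnion F₂ ↔ ∀ i : Fin n, τ i = PieoType.one) := by
  set L := G (Fin.last n)
  have hanti (v : Ω) : Antitone fun i => countMem (G i) v :=
    Fin.antitone_iff_succ_le.2 fun i => (hstep i).countMem_le v
  have h₁ := pairwise_disjoint_iff_countMem_le_one.1 hF₁
  have h₂ := pairwise_disjoint_iff_countMem_le_one.1 hF₂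
  have hcount₀ (v : Ω) : countMem (G 0) v = countMem F₁ v + countMem F₂ v := by
    simp [hG0, countMem]
  have hle₀ (v : Ω) (i : Fin (n + 1)) : countMem (G i) v ≤ countMem (G 0) v :=
    hanti v (Fin.zero_le i)
  have hmem (v : Ω) : v ∈ msUnion (L - maxMembers L) ↔ 2 ≤ countMem L v := by
    rw [mem_msUnion_iff_countMem_pos, hlam.countMem_sub_maxMembers]
    omega
  have hmem₀ (v : Ω) : v ∈ msUnion F₁ ∩ msUnion F₂ ↔ 2 ≤ countMem (G 0) v := by
    rw [Finset.mem_inter, mem_msUnion_iff_countMem_pos, mem_msUnion_iff_countMem_pos, hcount₀]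
    have := h₁ v
    have := h₂ v
    omega
  refine ⟨⟨hlam.pairwise_disjoint_maxMembers, ?_, fun v hv => ?_⟩, fun h i => ?_, fun h => ?_⟩
  · refine pairwise_disjoint_iff_countMem_le_one.2 fun v => ?_
    rw [hlam.countMem_sub_maxMembers]
    have : countMem L v ≤ countMem (G 0) v := hle₀ v (Fin.last n)
    have := hcount₀ v
    have := h₁ v
    have := h₂ v
    omega
  · exact (hmem₀ v).2 (((hmem v).1 hv).trans (hle₀ v _))
  · by_contra hτ
    obtain ⟨v, hv, hlt⟩ := (hstep i).exists_countMem_lt hτ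
    have hL : 2 ≤ countMem L v := by
      rw [← hmem, h, hmem₀]
      exact hv.trans (hle₀ v _)
    have hlast : countMem L v ≤ countMem (G i.succ) v := hanti v (Fin.le_last _)
    have := hle₀ v i.castSucc
    have := hcount₀ v
    have := h₁ v
    have := h₂ v
    omega
  · have heq (v : Ω) (i : Fin (n + 1)) : countMem (G i) v = countMem (G 0) v := by
      induction i using Fin.induction with
      | zero => rfl
      | succ i ih => exact ((h i ▸ hstep i).countMem_eq v).trans ih
    ext v
    rw [hmem, hmem₀, heq v (Fin.last n)]
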